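/- Let (U, τ) be a Curtis table for a based complex. If τ_i(k) = j, then j is the minimum of the set { leading index of d_{i−1}(x) : x ∈ X_{i−1} has leading index k and d_{i−1}(x) ≠ 0 } (in particular this set is nonempty). -/

import Mathlib

/-- The leading index (an element of `WithBot (Fin m)`, which is `⊥` exactly for the zero
vector) of a vector of the based `𝔽₂`-vector space `Fin m → ZMod 2`, whose ordered basis is
the standard one. -/
def lead {m : ℕ} (v : Fin m → ZMod 2) : WithBot (Fin m) :=
  (Finset.univ.filter fun j => v j ≠ 0).max

/-- `LTset S` is the set of leading indices of the nonzero elements of the subspace `S`. -/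
def LTset {m : ℕ} (S : Submodule (ZMod 2) (Fin m → ZMod 2)) : Set (Fin m) :=
  {j | ∃ v ∈ S, v ≠ 0 ∧ lead v = (j : WithBot (Fin m))}

/-- A based complex `X_0 → X_1 → ⋯ → X_N` of finite-dimensional `𝔽₂`-vector spaces with
ordered bases: `X_i` is modelled as `Fin (n i) → ZMod 2` via its ordered basis, and the
complex is extended by zero spaces in degrees `> N` (so `d_N = 0` holds automatically). -/
structure BasedComplex where
  N : ℕ
  n : ℕ → ℕ
  n_eq_zero : ∀ i, N < i → n i = 0
  d : ∀ i : ℕ, (Fin (n i) → ZMod 2) →ₗ[ZMod 2] (Fin (n (i + 1)) → ZMod 2)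
  d_comp : ∀ i, (d (i + 1)).comp (d i) = 0

namespace BasedComplex

/-- The cycles `ker d_i`. -/
def cyc (C : BasedComplex) (i : ℕ) : Submodule (ZMod 2) (Fin (C.n i) → ZMod 2) :=
  LinearMap.ker (C.d i)

/-- The boundaries `im d_{i-1}`, with the convention `d_{-1} = 0`. -/
def bdry (C : BasedComplex) : ∀ i : ℕ, Submodule (ZMod 2) (Fin (C.n i) → ZMod 2)
  | 0 => ⊥
  | (i + 1) => LinearMap.range (C.d i)

theorem bdry_zero (C : BasedComplex) : C.bdry 0 = ⊥ := rfl

theorem bdry_succ (C : BasedComplex) (i : ℕ) :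
    C.bdry (i + 1) = LinearMap.range (C.d i) := rfl

/-- The boundaries, viewed as a submodule of the cycles. -/
def bdryIn (C : BasedComplex) (i : ℕ) : Submodule (ZMod 2) (C.cyc i) :=
  (C.bdry i).comap (C.cyc i).subtype

/-- The homology `H_i = ker d_i / im d_{i-1}`. -/
abbrev homology (C : BasedComplex) (i : ℕ) :=
  C.cyc i ⧸ C.bdryIn i

end BasedComplex

/-- Given tag data `t`, where `t i k = some j` means that the basis index `k` of `X_i` is
tagged with target the basis index `j` of `X_{i+1}` (i.e. `τ_{i+1}(k) = j`),
`tagImage C t i` is the image of the partial function `τ_i` (which is empty for `i = 0`). -/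
def tagImage (C : BasedComplex) (t : ∀ i, Fin (C.n i) → Option (Fin (C.n (i + 1)))) :
    ∀ i : ℕ, Set (Fin (C.n i))
  | 0 => ∅
  | (i + 1) => {j | ∃ k, t i k = some j}

/-- A Curtis table for a based complex.  Here `t i` encodes the injective partial function
`τ_{i+1}` from the basis indices of `X_i` to the basis indices of `X_{i+1}`
(`t i k = some j` means `τ_{i+1}(k) = j`; the partial function `τ_0` is empty by
convention, and `τ_{N+1}` is automatically empty since `X_{N+1} = 0`). -/
structure CurtisTable (C : BasedComplex) where
  /-- the untagged items in each degree -/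
  U : ∀ i, Set (Fin (C.n i))
  /-- the tags -/
  t : ∀ i, Fin (C.n i) → Option (Fin (C.n (i + 1)))
  /-- the tags form an injective partial function -/
  t_inj : ∀ i k k' j, t i k = some j → t i k' = some j → k = k'
  /-- (i): `U_i` and the image of `τ_i` are disjoint … -/
  disj : ∀ i, Disjoint (U i) (tagImage C t i)
  /-- (i): … and their union is `LT(ker d_i)` -/
  union_eq : ∀ i, U i ∪ tagImage C t i = LTset (C.cyc i)
  /-- (ii): no index is both untagged and in the domain of `τ_{i+1}` -/
  mem_U_not_dom : ∀ i j, j ∈ U i → t i j = none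
  /-- (ii): no index is both in the image of `τ_i` and in the domain of `τ_{i+1}` -/
  mem_tagImage_not_dom : ∀ i j, j ∈ tagImage C t i → t i j = none
  /-- (ii): every basis index is untagged, or in the image of `τ_i`, or in the domain of
  `τ_{i+1}` -/
  cover : ∀ i j, j ∈ U i ∨ j ∈ tagImage C t i ∨ (t i j).isSome
  /-- (iii): if `τ_{i+1}(k) = j` then there is an `x` with leading index `k` such that
  `d_i x ≠ 0` and `d_i x` has leading index `j` -/
  tag_spec : ∀ i k j, t i k = some j →
    ∃ x : Fin (C.n i) → ZMod 2, lead x = (k : WithBot (Fin (C.n i))) ∧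
      C.d i x ≠ 0 ∧ lead (C.d i x) = (j : WithBot (Fin (C.n (i + 1))))

theorem lead_eq_bot_iff {m : ℕ} {v : Fin m → ZMod 2} : lead v = ⊥ ↔ v = 0 := by
  simp [lead, Finset.max_eq_bot, Finset.filter_eq_empty_iff, funext_iff]

theorem lead_lt_coe_iff {m : ℕ} {v : Fin m → ZMod 2} {k : Fin m} :
    lead v < (k : WithBot (Fin m)) ↔ ∀ l, k ≤ l → v l = 0 := by
  rw [lead, Finset.max_eq_sup_withBot, Finset.sup_lt_iff (WithBot.bot_lt_coe k)]
  simp only [Finset.mem_filter, Finset.mem_univ, true_and, WithBot.coe_lt_coe]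
  refine forall_congr' fun l => ?_
  rw [← not_le, not_imp_not]

theorem lead_eq_coe_iff {m : ℕ} {v : Fin m → ZMod 2} {k : Fin m} :
    lead v = (k : WithBot (Fin m)) ↔ v k ≠ 0 ∧ ∀ l, k < l → v l = 0 := by
  constructor
  · intro h
    refine ⟨(Finset.mem_filter.1 (Finset.mem_of_max h)).2, fun l hl => ?_⟩
    refine lead_lt_coe_iff.1 ?_ l le_rfl
    rw [h]
    exact WithBot.coe_lt_coe.2 hl
  · rintro ⟨hk, hl⟩
    refine le_antisymm (Finset.max_le fun l hlm => ?_) (Finset.le_max (by simpa using hk))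
    rw [WithBot.coe_le_coe]
    by_contra! hkl
    exact (Finset.mem_filter.1 hlm).2 (hl l hkl)

theorem lead_add_lt {m : ℕ} {v w : Fin m → ZMod 2} {k : Fin m}
    (hv : lead v = (k : WithBot (Fin m))) (hw : lead w = (k : WithBot (Fin m))) :
    lead (v + w) < (k : WithBot (Fin m)) := by
  rw [lead_eq_coe_iff] at hv hw
  refine lead_lt_coe_iff.2 fun l hl => ?_
  rcases hl.eq_or_lt with rfl | hl
  · rw [Pi.add_apply, Fin.eq_one_of_ne_zero _ hv.1, Fin.eq_one_of_ne_zero _ hw.1]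
    rfl
  · rw [Pi.add_apply, hv.2 l hl, hw.2 l hl, add_zero]

theorem lead_add_of_lt {m : ℕ} {v w : Fin m → ZMod 2} {k : Fin m}
    (hv : lead v < (k : WithBot (Fin m))) (hw : lead w = (k : WithBot (Fin m))) :
    lead (v + w) = (k : WithBot (Fin m)) := by
  rw [lead_lt_coe_iff] at hv
  rw [lead_eq_coe_iff] at hw ⊢
  refine ⟨by simpa [hv k le_rfl] using hw.1, fun l hl => ?_⟩
  rw [Pi.add_apply, hv l hl.le, hw.2 l hl, add_zero]

theorem exists_lead_eq_coe {m : ℕ} {v : Fin m → ZMod 2} (hv : v ≠ 0) :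
    ∃ k : Fin m, lead v = (k : WithBot (Fin m)) := by
  obtain ⟨k, hk⟩ := WithBot.ne_bot_iff_exists.1 (lead_eq_bot_iff.not.2 hv)
  exact ⟨k, hk.symm⟩

theorem ne_zero_of_lead_eq_coe {m : ℕ} {v : Fin m → ZMod 2} {k : Fin m}
    (hv : lead v = (k : WithBot (Fin m))) : v ≠ 0 := by
  rintro rfl
  exact (lead_eq_coe_iff.1 hv).1 rfl

/-- The leading index of a boundary `d x` is tagged by an index that is at most the leading
index of `x`. -/
theorem CurtisTable.exists_tag_of_lead_d {C : BasedComplex} (T : CurtisTable C) (i : ℕ)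
    (w : Fin (C.n i) → ZMod 2) (l : Fin (C.n (i + 1)))
    (hl : lead (C.d i w) = (l : WithBot (Fin (C.n (i + 1))))) :
    ∃ k : Fin (C.n i), (k : WithBot (Fin (C.n i))) ≤ lead w ∧ T.t i k = some l := by
  induction hm : lead w using WellFoundedLT.induction generalizing w l with
  | ind a ih =>
  subst hm
  have hw : w ≠ 0 := by
    rintro rfl
    exact ne_zero_of_lead_eq_coe hl (map_zero _)
  obtain ⟨m, hm⟩ := exists_lead_eq_coe hw
  by_cases hker : m ∈ LTset (C.cyc i)
  · obtain ⟨z, hz, -, hzm⟩ := hker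
    have hlt : lead (w + z) < lead w := by
      rw [hm]
      exact lead_add_lt hm hzm
    have hd : C.d i (w + z) = C.d i w := by
      rw [map_add, LinearMap.mem_ker.1 hz, add_zero]
    obtain ⟨k, hk, hkl⟩ := ih _ hlt (w + z) l (by rw [hd, hl]) rfl
    exact ⟨k, hk.trans hlt.le, hkl⟩
  · rw [← T.union_eq] at hker
    have hdom : (T.t i m).isSome :=
      ((T.cover i m).resolve_left fun h => hker (.inl h)).resolve_left fun h => hker (.inr h)
    obtain ⟨j, hj⟩ := Option.isSome_iff_exists.1 hdom
    obtain ⟨x, hx, -, hdx⟩ := T.tag_spec i m j hj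
    have hlt : lead (w + x) < lead w := by
      rw [hm]
      exact lead_add_lt hm hx
    rcases lt_trichotomy l j with hlj | rfl | hlj
    · have hlead : lead (C.d i (w + x)) = (j : WithBot (Fin (C.n (i + 1)))) := by
        rw [map_add]
        exact lead_add_of_lt (by rw [hl]; exact WithBot.coe_lt_coe.2 hlj) hdx
      obtain ⟨k, hk, hkj⟩ := ih _ hlt (w + x) j hlead rfl
      rw [T.t_inj i k m j hkj hj, ← hm] at hk
      exact absurd hk hlt.not_ge
    · exact ⟨m, hm.ge, hj⟩
    · have hlead : lead (C.d i (w + x)) = (l : WithBot (Fin (C.n (i + 1)))) := by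
        rw [add_comm w x, map_add]
        exact lead_add_of_lt (by rw [hdx]; exact WithBot.coe_lt_coe.2 hlj) hl
      obtain ⟨k, hk, hkl⟩ := ih _ hlt (w + x) l hlead rfl
      exact ⟨k, hk.trans hlt.le, hkl⟩

/-- If `τ_{i+1}(k) = j`, then `j` is the minimum of the (nonempty) set of leading indices
of the nonzero vectors `d_i x` over all `x` with leading index `k`. -/
theorem tag_isLeast (C : BasedComplex) (T : CurtisTable C) (i : ℕ)
    (k : Fin (C.n i)) (j : Fin (C.n (i + 1))) (h : T.t i k = some j) :
    IsLeast {j' : Fin (C.n (i + 1)) | ∃ x : Fin (C.n i) → ZMod 2,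
      lead x = (k : WithBot (Fin (C.n i))) ∧ C.d i x ≠ 0 ∧
      lead (C.d i x) = (j' : WithBot (Fin (C.n (i + 1))))} j := by
  refine ⟨T.tag_spec i k j h, ?_⟩
  rintro j' ⟨y, hy, -, hdy⟩
  by_contra! hlt
  obtain ⟨x, hx, -, hdx⟩ := T.tag_spec i k j h
  have hlead : lead (C.d i (y + x)) = (j : WithBot (Fin (C.n (i + 1)))) := by
    rw [map_add]
    exact lead_add_of_lt (by rw [hdy]; exact WithBot.coe_lt_coe.2 hlt) hdx
  obtain ⟨k', hk', hkj⟩ := T.exists_tag_of_lead_d i (y + x) j hlead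
  rw [T.t_inj i k' k j hkj h] at hk'
  exact (lead_add_lt hy hx).not_ge hk'
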